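/- arXiv:0904.0635 — 2 statements merged into one kernel-verified Lean document; each statement's English description precedes it below -/
import Mathlib

section
/- Suppose the joint density factorizes as f(t, s) = h₀(t − m(s)) p(s) for all (t, s) ∈ ℝ × ℝ^d, where h₀ : ℝ → ℝ is a probability density, p : ℝ^d → ℝ is a probability density, and m : ℝ^d → ℝ is an affine map. Fix s₀ ∈ ℝ^d. Let (θ, S) be a random vector with density f and define the adjusted parameter θ* = m(s₀) + θ − m(S). Then (θ*, S) has joint density (t, s) ↦ h₀(t − m(s₀)) p(s); in particular, θ* is independent of S and θ* has density t ↦ h₀(t − m(s₀)), which is the conditional density g(·|s₀) of θ given S = s₀. -/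
open MeasureTheory Filter Matrix Asymptotics
open scoped Topology

theorem linear_adjustment_exact_homoscedastic
    (d : ℕ) (hd : 1 ≤ d)
    (h₀ : ℝ → ℝ) (hh₀_meas : Measurable h₀) (hh₀_nonneg : ∀ t, 0 ≤ h₀ t)
    (hh₀_int : (∫ t : ℝ, h₀ t) = 1)
    (p : (Fin d → ℝ) → ℝ) (hp_meas : Measurable p) (hp_nonneg : ∀ s, 0 ≤ p s)
    (hp_int : (∫ s : Fin d → ℝ, p s) = 1)
    (m : (Fin d → ℝ) → ℝ)
    (hm_affine : ∃ (w : Fin d → ℝ) (c : ℝ), ∀ s, m s = (∑ i, w i * s i) + c)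
    (f : ℝ → (Fin d → ℝ) → ℝ) (hf_def : ∀ t s, f t s = h₀ (t - m s) * p s)
    (s₀ : Fin d → ℝ)
    (Ω : Type*) [MeasurableSpace Ω] (μ : Measure Ω) [IsProbabilityMeasure μ]
    (θ : Ω → ℝ) (S : Ω → Fin d → ℝ)
    (hmeas : Measurable fun ω => (θ ω, S ω))
    (hlaw : Measure.map (fun ω => (θ ω, S ω)) μ
      = (volume : Measure (ℝ × (Fin d → ℝ))).withDensity
          (fun x => ENNReal.ofReal (f x.1 x.2)))
    (θstar : Ω → ℝ) (hθstar : ∀ ω, θstar ω = m s₀ + θ ω - m (S ω)) :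
    Measure.map (fun ω => (θstar ω, S ω)) μ
        = (volume : Measure (ℝ × (Fin d → ℝ))).withDensity
            (fun x => ENNReal.ofReal (h₀ (x.1 - m s₀) * p x.2)) ∧
      ProbabilityTheory.IndepFun θstar S μ ∧
      Measure.map θstar μ
        = (volume : Measure ℝ).withDensity (fun t => ENNReal.ofReal (h₀ (t - m s₀))) ∧
      (0 < p s₀ → ∀ t, h₀ (t - m s₀) = f t s₀ / p s₀) := by
  have hm : Measurable m := by
    obtain ⟨w, c, h⟩ := hm_affine
    have : m = fun s => (∑ i, w i * s i) + c := funext h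
    rw [this]
    fun_prop
  have hθ : Measurable θ := measurable_fst.comp hmeas
  have hS : Measurable S := measurable_snd.comp hmeas
  have hst : Measurable θstar := by
    have : θstar = fun ω => m s₀ + θ ω - m (S ω) := funext hθstar
    rw [this]
    exact (hθ.const_add _).sub (hm.comp hS)
  have hT : MeasurePreserving (fun x : ℝ × (Fin d → ℝ) => (m s₀ + x.1 - m x.2, x.2))
      volume volume := by
    have h1 : MeasurePreserving
        (fun x : (Fin d → ℝ) × ℝ => (id x.1, (fun s t => m s₀ + t - m s) x.1 x.2))
        ((volume : Measure (Fin d → ℝ)).prod (volume : Measure ℝ))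
        ((volume : Measure (Fin d → ℝ)).prod (volume : Measure ℝ)) := by
      refine MeasurePreserving.skew_product (g := fun s t => m s₀ + t - m s)
        (MeasurePreserving.id (volume : Measure (Fin d → ℝ))) ?_ ?_
      · have : Measurable (fun x : (Fin d → ℝ) × ℝ => m s₀ + x.2 - m x.1) := by fun_prop
        exact this
      · refine Eventually.of_forall fun s => ?_
        have : (fun t : ℝ => m s₀ + t - m s) = fun t => (m s₀ - m s) + t := by
          funext t; ring
        simp only [this]
        exact map_add_left_eq_self _ _
    exact (Measure.measurePreserving_swap.comp h1).comp Measure.measurePreserving_swap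
  have hG : Measurable (fun x : ℝ × (Fin d → ℝ) =>
      ENNReal.ofReal (h₀ (x.1 - m s₀) * p x.2)) := by fun_prop
  have hjoint : Measure.map (fun ω => (θstar ω, S ω)) μ
        = (volume : Measure (ℝ × (Fin d → ℝ))).withDensity
            (fun x => ENNReal.ofReal (h₀ (x.1 - m s₀) * p x.2)) := by
    have e : (fun ω => (θstar ω, S ω)) =
        (fun x : ℝ × (Fin d → ℝ) => (m s₀ + x.1 - m x.2, x.2)) ∘ (fun ω => (θ ω, S ω)) := by
      funext ω; simp [hθstar]
    rw [e, ← Measure.map_map hT.measurable hmeas, hlaw]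
    ext A hA
    rw [Measure.map_apply hT.measurable hA, withDensity_apply _ (hT.measurable hA),
      withDensity_apply _ hA, ← hT.setLIntegral_comp_preimage hA hG]
    refine lintegral_congr fun x => ?_
    rw [hf_def]
    congr 3
    ring
  have i1 : ∫⁻ t, ENNReal.ofReal (h₀ (t - m s₀)) = 1 := by
    rw [lintegral_sub_right_eq_self (fun t => ENNReal.ofReal (h₀ t)),
      ← ofReal_integral_eq_lintegral_ofReal
      (by by_contra h; rw [integral_undef h] at hh₀_int; simp at hh₀_int)
      (Eventually.of_forall hh₀_nonneg), hh₀_int, ENNReal.ofReal_one]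
  have i2 : ∫⁻ s, ENNReal.ofReal (p s) = 1 := by
    rw [← ofReal_integral_eq_lintegral_ofReal
      (by by_contra h; rw [integral_undef h] at hp_int; simp at hp_int)
      (Eventually.of_forall hp_nonneg), hp_int, ENNReal.ofReal_one]
  have P1 : IsProbabilityMeasure
      ((volume : Measure ℝ).withDensity (fun t => ENNReal.ofReal (h₀ (t - m s₀)))) :=
    ⟨by simpa using i1⟩
  have P2 : IsProbabilityMeasure
      ((volume : Measure (Fin d → ℝ)).withDensity (fun s => ENNReal.ofReal (p s))) :=
    ⟨by simpa using i2⟩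
  have hprod : Measure.map (fun ω => (θstar ω, S ω)) μ =
      ((volume : Measure ℝ).withDensity (fun t => ENNReal.ofReal (h₀ (t - m s₀)))).prod
      ((volume : Measure (Fin d → ℝ)).withDensity (fun s => ENNReal.ofReal (p s))) := by
    rw [hjoint, prod_withDensity (by fun_prop) (by fun_prop)]
    simp only [ENNReal.ofReal_mul (hh₀_nonneg _)]
    rfl
  have m1 : Measure.map θstar μ
      = (volume : Measure ℝ).withDensity (fun t => ENNReal.ofReal (h₀ (t - m s₀))) := by
    have := congrArg (Measure.map Prod.fst) hprod
    rw [Measure.map_map measurable_fst (hst.prodMk hS), Measure.map_fst_prod] at this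
    rw [measure_univ, one_smul] at this
    exact this
  have m2 : Measure.map S μ
      = (volume : Measure (Fin d → ℝ)).withDensity (fun s => ENNReal.ofReal (p s)) := by
    have := congrArg (Measure.map Prod.snd) hprod
    rw [Measure.map_map measurable_snd (hst.prodMk hS), Measure.map_snd_prod] at this
    rw [measure_univ, one_smul] at this
    exact this
  refine ⟨hjoint, ?_, m1, ?_⟩
  · rw [ProbabilityTheory.indepFun_iff_map_prod_eq_prod_map_map hst.aemeasurable
      hS.aemeasurable, m1, m2, hprod]
  · intro hp t
    rw [hf_def, mul_div_cancel_right₀ _ hp.ne']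
end

section
/- Suppose in addition that there are a neighborhood U of s₀ and a twice continuously differentiable probability density h₀ : ℝ → ℝ such that g(t|s) = h₀(t − m(s)) for all s ∈ U and all t ∈ ℝ (homoscedastic model). Define N₂(B, b') = ∫_ℝ ∫_{ℝ^d} K̃_{b'}( t − ∇m(s₀)ᵀ(s − s₀) − (1/2)(s − s₀)ᵀ ∇²m(s₀)(s − s₀) − θ₀ ) K_B(s − s₀) f(t, s) ds dt and D(B) = ∫_{ℝ^d} K_B(s − s₀) p(s) ds. Then, as b' → 0⁺ and ‖B‖ → 0 along any sequences of positive reals and nonsingular d×d matrices, N₂(B, b')/D(B) − g(θ₀|s₀) = (1/2) μ₂(K̃) h₀''(ε) b'² + o(b'² + tr(BᵀB)); that is, the bias constant C₂,₂ of the quadratic-adjustment estimator vanishes and its smoothing bias in the summary-statistics space is of smaller order than tr(BᵀB). -/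
open MeasureTheory Filter Matrix Asymptotics
open scoped Topology

lemma aux_taylor2 {E : Type*} [NormedAddCommGroup E] [NormedSpace ℝ E] (m : E → ℝ) (s₀ : E)
    (hm : ContDiffAt ℝ 2 m s₀) (η : ℝ) (hη : 0 < η) :
    ∃ δ > 0, ∀ v, ‖v‖ < δ →
      |m (s₀ + v) - m s₀ - fderiv ℝ m s₀ v - (1/2) * fderiv ℝ (fderiv ℝ m) s₀ v v| ≤ η * ‖v‖^2 := by
  have h1 : ∀ᶠ s in 𝓝 s₀, DifferentiableAt ℝ m s :=
    (hm.eventually (by simp)).mono fun s hs => hs.differentiableAt (by simp)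
  have h2 : DifferentiableAt ℝ (fderiv ℝ m) s₀ :=
    (hm.fderiv_right (m := 1) (by norm_num)).differentiableAt (by simp)
  have h3 := (h2.hasFDerivAt.isLittleO.def hη)
  obtain ⟨δ, hδ, hb⟩ := Metric.eventually_nhds_iff_ball.1 (h1.and h3)
  refine ⟨δ, hδ, fun v hv => ?_⟩
  have hmem : ∀ τ ∈ Set.Icc (0:ℝ) 1, s₀ + τ • v ∈ Metric.ball s₀ δ := by
    intro τ hτ
    rw [Metric.mem_ball, dist_eq_norm, add_sub_cancel_left, norm_smul, Real.norm_eq_abs, abs_of_nonneg hτ.1]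
    nlinarith [norm_nonneg v, hτ.2]
  have hder : ∀ τ ∈ Set.Icc (0:ℝ) 1, HasDerivWithinAt
      (fun τ : ℝ => m (s₀ + τ • v) - τ * fderiv ℝ m s₀ v - τ^2 * ((1/2) * fderiv ℝ (fderiv ℝ m) s₀ v v))
      (fderiv ℝ m (s₀ + τ • v) v - fderiv ℝ m s₀ v - τ * fderiv ℝ (fderiv ℝ m) s₀ v v) (Set.Icc 0 1) τ := by
    intro τ hτ
    have e1 : HasDerivAt (fun τ : ℝ => s₀ + τ • v) v τ := by
      simpa using ((hasDerivAt_id τ).smul_const v).const_add s₀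
    have e2 := (hb _ (hmem τ hτ)).1.hasFDerivAt.comp_hasDerivAt τ e1
    have e3 := (hasDerivAt_id τ).mul_const (fderiv ℝ m s₀ v)
    have e4 := (hasDerivAt_pow 2 τ).mul_const ((1/2) * fderiv ℝ (fderiv ℝ m) s₀ v v)
    have e5 := (e2.sub e3).sub e4
    refine HasDerivAt.hasDerivWithinAt (e5.congr_deriv ?_)
    simp; ring
  have key := norm_image_sub_le_of_norm_deriv_le_segment_01' (C := η * ‖v‖^2) hder ?_
  · rw [Real.norm_eq_abs] at key
    convert! key using 2
    simp; ring
  · intro τ hτ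
    have hτ' : τ ∈ Set.Icc (0:ℝ) 1 := ⟨hτ.1, hτ.2.le⟩
    have h4 := (hb _ (hmem τ hτ')).2
    rw [add_sub_cancel_left] at h4
    have h5 := ContinuousLinearMap.le_of_opNorm_le _ h4 v
    simp only [_root_.sub_apply, map_smul, _root_.smul_apply, smul_eq_mul, norm_smul, Real.norm_eq_abs, abs_of_nonneg hτ.1] at h5
    rw [Real.norm_eq_abs]
    refine h5.trans ?_
    have : 0 ≤ η * ‖v‖^2 := by positivity
    nlinarith [hτ.2]

lemma aux_taylor1d (h : ℝ → ℝ) (e : ℝ) (hh : ContDiff ℝ 2 h) (η : ℝ) (hη : 0 < η) :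
    ∃ δ > 0, ∀ x, |x| < δ →
      |h (e + x) - h e - deriv h e * x - (1/2) * deriv (deriv h) e * x^2| ≤ η * x^2 := by
  obtain ⟨δ, hδ, H⟩ := aux_taylor2 h e hh.contDiffAt η hη
  refine ⟨δ, hδ, fun x hx => ?_⟩
  have := H x hx
  have d1 : fderiv ℝ h e x = deriv h e * x := by
    rw [fderiv_eq_smul_deriv]; simp [mul_comm]
  have hd : DifferentiableAt ℝ (fderiv ℝ h) e :=
    (hh.contDiffAt.fderiv_right (m := 1) (by norm_num)).differentiableAt (by simp)
  have d2 : fderiv ℝ (fderiv ℝ h) e x x = deriv (deriv h) e * x^2 := by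
    have : deriv (deriv h) e = fderiv ℝ (fderiv ℝ h) e 1 1 := by
      have e1 : deriv h = fun y => fderiv ℝ h y 1 := by ext y; simp
      rw [e1]
      have := (hd.hasFDerivAt.clm_apply (hasFDerivAt_const (1:ℝ) e)).hasDerivAt.deriv
      rw [this]; simp
    rw [this]
    have hx1 : fderiv ℝ (fderiv ℝ h) e (x • (1:ℝ)) (x • (1:ℝ)) = x * (x * fderiv ℝ (fderiv ℝ h) e 1 1) := by
      rw [map_smul, map_smul]; rfl
    simp only [smul_eq_mul, mul_one] at hx1
    rw [hx1]; ring
  rw [d1, d2, Real.norm_eq_abs, sq_abs] at this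
  convert! this using 2; ring

lemma aux_taylorM {d : ℕ} (m : (Fin d → ℝ) → ℝ) (s₀ : Fin d → ℝ) (hm : ContDiffAt ℝ 2 m s₀)
    (gm : Fin d → ℝ) (hgm : ∀ i, gm i = fderiv ℝ m s₀ (Pi.single i 1))
    (Hm : Matrix (Fin d) (Fin d) ℝ)
    (hHm : ∀ i j, Hm i j = fderiv ℝ (fun s => fderiv ℝ m s (Pi.single j 1)) s₀ (Pi.single i 1))
    (η : ℝ) (hη : 0 < η) :
    ∃ δ > 0, ∀ s, ‖s - s₀‖ < δ →
      |m s - m s₀ - gm ⬝ᵥ (s - s₀) - (1/2) * ((s - s₀) ⬝ᵥ (Hm *ᵥ (s - s₀)))| ≤ η * ‖s - s₀‖^2 := by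
  obtain ⟨δ, hδ, H⟩ := aux_taylor2 m s₀ hm η hη
  have hd : DifferentiableAt ℝ (fderiv ℝ m) s₀ :=
    (hm.fderiv_right (m := 1) (by norm_num)).differentiableAt (by simp)
  have e0 : ∀ v : Fin d → ℝ, v = ∑ i, v i • (Pi.single i (1:ℝ) : Fin d → ℝ) := fun v => by
    ext j; simp [Finset.sum_apply, Pi.single_apply]
  have d1 : ∀ v, fderiv ℝ m s₀ v = gm ⬝ᵥ v := fun v => by
    conv_lhs => rw [e0 v]
    simp [map_sum, dotProduct, hgm, mul_comm]
  have hH : ∀ i j, Hm i j = fderiv ℝ (fderiv ℝ m) s₀ (Pi.single i 1) (Pi.single j 1) := fun i j => by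
    rw [hHm, (hd.hasFDerivAt.clm_apply (hasFDerivAt_const (Pi.single j (1:ℝ) : Fin d → ℝ) s₀)).fderiv]
    simp
  have d2 : ∀ v, fderiv ℝ (fderiv ℝ m) s₀ v v = v ⬝ᵥ (Hm *ᵥ v) := fun v => by
    conv_lhs => rw [e0 v]
    simp only [map_sum, map_smul, _root_.sum_apply, _root_.smul_apply, dotProduct, mulVec, hH, smul_eq_mul, Finset.mul_sum]
    rw [Finset.sum_comm]
    refine Finset.sum_congr rfl fun i _ => Finset.sum_congr rfl fun j _ => ?_
    ring
  refine ⟨δ, hδ, fun s hs => ?_⟩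
  have := H _ hs
  rwa [d1, d2, add_sub_cancel] at this

lemma aux_normB {d : ℕ} (A : Matrix (Fin d) (Fin d) ℝ) (u : Fin d → ℝ) :
    ‖A *ᵥ u‖^2 ≤ (Aᵀ * A).trace * (d * ‖u‖^2) := by
  have ht : (Aᵀ * A).trace = ∑ i, ∑ j, A i j ^2 := by
    simp only [trace, diag, mul_apply, transpose_apply]
    rw [Finset.sum_comm]; simp [sq]
  have hu : ∑ j, u j ^2 ≤ d * ‖u‖^2 := by
    have : ∑ j : Fin d, u j ^2 ≤ ∑ j : Fin d, ‖u‖^2 := Finset.sum_le_sum fun j _ => by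
      rw [← sq_abs]; exact pow_le_pow_left₀ (abs_nonneg _) (norm_le_pi_norm u j) 2
    simpa using this
  have ht0 : 0 ≤ (Aᵀ * A).trace := by rw [ht]; positivity
  have : ‖A *ᵥ u‖ ≤ √((Aᵀ * A).trace * (d * ‖u‖^2)) := by
    rw [pi_norm_le_iff_of_nonneg (by positivity)]
    intro i
    apply Real.le_sqrt_of_sq_le
    rw [Real.norm_eq_abs, sq_abs]
    calc (A *ᵥ u) i ^2 ≤ (∑ j, A i j ^2) * ∑ j, u j ^2 := Finset.sum_mul_sq_le_sq_mul_sq Finset.univ (fun j => A i j) u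
      _ ≤ _ := by
        gcongr
        rw [ht]
        exact Finset.single_le_sum (f := fun i => ∑ j, A i j ^2) (fun _ _ => by positivity) (Finset.mem_univ i)
  calc ‖A *ᵥ u‖^2 ≤ (√((Aᵀ * A).trace * (d * ‖u‖^2)))^2 := by gcongr
    _ = _ := Real.sq_sqrt (by positivity)

lemma aux_cov {d : ℕ} (A : Matrix (Fin d) (Fin d) ℝ) (hA : A.det ≠ 0) (s₀ : Fin d → ℝ)
    (F : (Fin d → ℝ) → ℝ) :
    ∫ s, |A.det|⁻¹ * F (A⁻¹ *ᵥ (s - s₀)) = ∫ u, F u := by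
  rw [integral_const_mul, integral_sub_right_eq_self (fun s => F (A⁻¹ *ᵥ s)) s₀]
  have hA' : A⁻¹.det ≠ 0 := by rw [det_nonsing_inv]; simpa using hA
  have hdet : LinearMap.det (toLin' A⁻¹) ≠ 0 := by rwa [LinearMap.det_toLin']
  let e := LinearEquiv.ofIsUnitDet (f := toLin' A⁻¹) (v := Pi.basisFun ℝ (Fin d)) (v' := Pi.basisFun ℝ (Fin d)) (by
    rw [LinearMap.toMatrix_eq_toMatrix', LinearMap.toMatrix'_toLin']; exact hA'.isUnit)
  have hmap := Measure.map_linearMap_addHaar_eq_smul_addHaar (μ := (volume : Measure (Fin d → ℝ))) hdet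
  have hemb : MeasurableEmbedding (toLin' A⁻¹) := e.toContinuousLinearEquiv.toHomeomorph.measurableEmbedding
  have := hemb.integral_map (μ := volume) F
  rw [hmap, integral_smul_measure] at this
  simp only [toLin'_apply] at this
  rw [← this, LinearMap.det_toLin', det_nonsing_inv]
  simp [abs_nonneg, hA]

lemma aux_supp_bdd {E : Type*} [NormedAddCommGroup E] (K : E → ℝ) (hK : HasCompactSupport K) :
    ∃ R, 0 ≤ R ∧ ∀ v, K v ≠ 0 → ‖v‖ ≤ R := by
  obtain ⟨R, hR⟩ := hK.isCompact.isBounded.exists_norm_le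
  exact ⟨max R 0, le_max_right _ _, fun v hv => (hR v (subset_tsupport _ hv)).trans (le_max_left _ _)⟩

lemma aux_int_cont (Kt : ℝ → ℝ) (hKt_meas : Measurable Kt)
    (hKt_bdd : ∃ M, ∀ u, |Kt u| ≤ M) (hKt_supp : HasCompactSupport Kt)
    (φ : ℝ → ℝ) (hφ : Continuous φ) : Integrable (fun v => Kt v * φ v) := by
  obtain ⟨M, hM⟩ := hKt_bdd
  have h1 : IntegrableOn Kt (tsupport Kt) :=
    Measure.integrableOn_of_bounded (M := M) (hKt_supp.isCompact.measure_lt_top.ne)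
      hKt_meas.aestronglyMeasurable (ae_of_all _ fun v => hM v)
  have h2 : IntegrableOn (fun v => Kt v * φ v) (tsupport Kt) :=
    h1.mul_continuousOn hφ.continuousOn hKt_supp.isCompact
  refine (integrableOn_iff_integrable_of_support_subset ?_).1 h2
  intro v hv
  exact subset_tsupport _ (left_ne_zero_of_mul hv)

lemma aux_smooth1d (h : ℝ → ℝ) (e : ℝ) (hh : ContDiff ℝ 2 h)
    (Kt : ℝ → ℝ) (hKt_meas : Measurable Kt)
    (hKt_bdd : ∃ M, ∀ u, |Kt u| ≤ M) (hKt_supp : HasCompactSupport Kt)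
    (hKt_nonneg : ∀ u, 0 ≤ Kt u)
    (hKt_int : (∫ u : ℝ, Kt u) = 1) (hKt_even : ∀ u, Kt (-u) = Kt u)
    (μ2Kt : ℝ) (hμ2Kt : μ2Kt = ∫ u : ℝ, u ^ 2 * Kt u) (η : ℝ) (hη : 0 < η) :
    ∃ δ > 0, ∀ r b, |r| < δ → 0 < b → b < δ →
      |(∫ v, Kt v * h (e + r + b * v)) -
        (h e + deriv h e * r + (1/2) * deriv (deriv h) e * (r^2 + μ2Kt * b^2))| ≤ η * (r^2 + μ2Kt * b^2) := by
  obtain ⟨δ, hδ, H⟩ := aux_taylor1d h e hh η hη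
  obtain ⟨R, hR0, hR⟩ := aux_supp_bdd Kt hKt_supp
  have hI := aux_int_cont Kt hKt_meas hKt_bdd hKt_supp
  refine ⟨δ / (1 + R), by positivity, fun r b hr hb hbδ => ?_⟩
  have m0 : ∫ v, Kt v * v = 0 := by
    have := integral_neg_eq_self (fun v => Kt v * v) volume
    simp only [hKt_even, mul_neg, integral_neg] at this
    linarith
  have m2 : ∫ v, Kt v * v^2 = μ2Kt := by rw [hμ2Kt]; simp_rw [mul_comm]
  have i0 : Integrable Kt := by simpa using hI (fun _ => 1) continuous_const
  have i1 := hI (fun v => v) continuous_id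
  have i2 := hI (fun v => v^2) (by fun_prop)
  have ih := hI (fun v => h (e + r + b * v)) (hh.continuous.comp (by fun_prop))
  have q2 : ∫ v, Kt v * (r + b * v)^2 = r^2 + μ2Kt * b^2 := by
    have : (fun v => Kt v * (r + b * v)^2) = fun v => r^2 * Kt v + (2 * r * b) * (Kt v * v) + b^2 * (Kt v * v^2) := by
      ext v; ring
    rw [this, integral_add, integral_add, integral_const_mul, integral_const_mul, integral_const_mul, m0, m2, hKt_int]
    · ring
    · exact i0.const_mul _
    · exact i1.const_mul _
    · exact (i0.const_mul _).add (i1.const_mul _)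
    · exact i2.const_mul _
  have q1 : ∫ v, Kt v * (r + b * v) = r := by
    have : (fun v => Kt v * (r + b * v)) = fun v => r * Kt v + b * (Kt v * v) := by
      ext v; ring
    rw [this, integral_add, integral_const_mul, integral_const_mul, m0, hKt_int]
    · ring
    · exact i0.const_mul _
    · exact i1.const_mul _
  have j1 := hI (fun v => r + b * v) (by fun_prop)
  have j2 := hI (fun v => (r + b * v)^2) (by fun_prop)
  have E : (∫ v, Kt v * h (e + r + b * v)) -
        (h e + deriv h e * r + (1/2) * deriv (deriv h) e * (r^2 + μ2Kt * b^2)) =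
      ∫ v, (Kt v * h (e + r + b * v) - h e * Kt v - deriv h e * (Kt v * (r + b * v))
        - (1/2) * deriv (deriv h) e * (Kt v * (r + b * v)^2)) := by
    rw [integral_sub, integral_sub, integral_sub, integral_const_mul, integral_const_mul, integral_const_mul, q1, q2, hKt_int]
    · ring
    · exact ih
    · exact i0.const_mul _
    · exact ih.sub (i0.const_mul _)
    · exact j1.const_mul _
    · exact (ih.sub (i0.const_mul _)).sub (j1.const_mul _)
    · exact j2.const_mul _
  rw [E, ← q2, ← integral_const_mul]
  rw [← Real.norm_eq_abs]
  refine norm_integral_le_of_norm_le (j2.const_mul η) (ae_of_all _ fun v => ?_)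
  rw [Real.norm_eq_abs]
  by_cases hv : Kt v = 0
  · simp [hv]
  have hx : |r + b * v| < δ := by
    have h1 : |v| ≤ R := hR v hv
    have h2 : |r + b * v| ≤ |r| + b * |v| := by
      refine (abs_add_le _ _).trans ?_
      rw [abs_mul, abs_of_pos hb]
    have h3 : b * |v| ≤ δ / (1 + R) * R := by gcongr
    have h4 : δ / (1 + R) + δ / (1 + R) * R = δ := by field_simp
    linarith
  have h5 := H _ hx
  have : Kt v * h (e + r + b * v) - h e * Kt v - deriv h e * (Kt v * (r + b * v))
        - (1/2) * deriv (deriv h) e * (Kt v * (r + b * v)^2) =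
      Kt v * (h (e + (r + b * v)) - h e - deriv h e * (r + b * v) - (1/2) * deriv (deriv h) e * (r + b * v)^2) := by
    rw [add_assoc e]; ring
  rw [this, abs_mul, abs_of_nonneg (hKt_nonneg v)]
  calc _ ≤ Kt v * (η * (r + b * v)^2) := by gcongr; exact hKt_nonneg v
    _ = _ := by ring

lemma aux_cov1 (Kt F : ℝ → ℝ) (c b : ℝ) (hb : 0 < b) :
    ∫ t, Kt ((t - c) / b) / b * F t = ∫ v, Kt v * F (c + b * v) := by
  have h1 := integral_sub_right_eq_self (μ := (volume : Measure ℝ)) (fun t => Kt (t / b) / b * F (t + c)) c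
  simp only [sub_add_cancel] at h1
  rw [h1]
  have h2 := Measure.integral_comp_div (fun v => Kt v * F (c + b * v)) b
  have h3 : ∫ t, Kt (t / b) / b * F (t + c) = ∫ t, b⁻¹ * (Kt (t / b) * F (c + b * (t / b))) := by
    congr 1; ext t
    rw [mul_div_cancel₀ _ hb.ne', add_comm c]; ring
  rw [h3, integral_const_mul, h2, abs_of_pos hb, smul_eq_mul, inv_mul_cancel_left₀ hb.ne']

set_option maxHeartbeats 2000000 in
lemma aux_local {d : ℕ} (h₀ : ℝ → ℝ) (hh : ContDiff ℝ 2 h₀)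
    (Kt : ℝ → ℝ) (hKt_meas : Measurable Kt)
    (hKt_bdd : ∃ M, ∀ u, |Kt u| ≤ M) (hKt_supp : HasCompactSupport Kt)
    (hKt_nonneg : ∀ u, 0 ≤ Kt u)
    (hKt_int : (∫ u : ℝ, Kt u) = 1) (hKt_even : ∀ u, Kt (-u) = Kt u)
    (μ2Kt : ℝ) (hμ2Kt : μ2Kt = ∫ u : ℝ, u ^ 2 * Kt u)
    (m : (Fin d → ℝ) → ℝ) (s₀ : Fin d → ℝ) (hm : ContDiffAt ℝ 2 m s₀)
    (gm : Fin d → ℝ) (hgm : ∀ i, gm i = fderiv ℝ m s₀ (Pi.single i 1))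
    (Hm : Matrix (Fin d) (Fin d) ℝ)
    (hHm : ∀ i j, Hm i j = fderiv ℝ (fun s => fderiv ℝ m s (Pi.single j 1)) s₀ (Pi.single i 1))
    (θ₀ ε : ℝ) (hε : ε = θ₀ - m s₀)
    (η : ℝ) (hη : 0 < η) :
    ∃ δ > 0, ∀ b, 0 < b → b < δ → ∀ s, ‖s - s₀‖ < δ →
      |(∫ v, Kt v * h₀ (gm ⬝ᵥ (s - s₀) + (1/2) * ((s - s₀) ⬝ᵥ (Hm *ᵥ (s - s₀))) + θ₀ + b * v - m s)) -
        (h₀ ε + (1/2) * μ2Kt * deriv (deriv h₀) ε * b^2)| ≤ η * (b^2 + ‖s - s₀‖^2) := by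
  have hμ : 0 ≤ μ2Kt := by
    rw [hμ2Kt]; exact integral_nonneg fun u => mul_nonneg (sq_nonneg _) (hKt_nonneg u)
  set A := |deriv h₀ ε|
  set A2 := |deriv (deriv h₀) ε|
  have hA : 0 ≤ A := abs_nonneg _
  have hA2 : 0 ≤ A2 := abs_nonneg _
  set η1 := η / (μ2Kt + 1) with hη1
  have hη1p : 0 < η1 := by positivity
  obtain ⟨δ1, hδ1, H1⟩ := aux_smooth1d h₀ ε hh Kt hKt_meas hKt_bdd hKt_supp hKt_nonneg hKt_int hKt_even μ2Kt hμ2Kt η1 hη1p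
  set η2 := min 1 (η / (A + A2 + η1)) with hη2
  have hη2p : 0 < η2 := by positivity
  obtain ⟨δ2, hδ2, H2⟩ := aux_taylorM m s₀ hm gm hgm Hm hHm η2 hη2p
  refine ⟨min (min δ1 δ2) 1, by positivity, fun b hb hbδ s hs => ?_⟩
  simp only [lt_min_iff] at hbδ hs
  have h2 := H2 s hs.1.2
  set q := gm ⬝ᵥ (s - s₀) + (1/2) * ((s - s₀) ⬝ᵥ (Hm *ᵥ (s - s₀))) with hq
  set r := q - (m s - m s₀) with hr
  set w := ‖s - s₀‖
  have hw : 0 ≤ w := norm_nonneg _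
  have hr1 : |r| ≤ η2 * w^2 := by
    rw [← abs_neg]; convert! h2 using 2; rw [hr, hq]; ring
  have hη21 : η2 ≤ 1 := min_le_left _ _
  have hw2 : w^2 ≤ w := by nlinarith
  have hrw : |r| ≤ w := by nlinarith [sq_nonneg w]
  have h1 := H1 r b (by linarith) hb hbδ.1.1
  have hint : (∫ v, Kt v * h₀ (q + θ₀ + b * v - m s)) = ∫ v, Kt v * h₀ (ε + r + b * v) := by
    congr 1; ext v; congr 2; rw [hr, hε]; ring
  rw [hint]
  set I := ∫ v, Kt v * h₀ (ε + r + b * v)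
  have hr2 : r^2 ≤ |r| := by rw [← sq_abs]; nlinarith [abs_nonneg r]
  have t1 : |deriv h₀ ε * r| = A * |r| := abs_mul _ _
  have t2 : |(1/2) * deriv (deriv h₀) ε * r^2| ≤ A2 * |r| := by
    have e1 : |(1/2) * deriv (deriv h₀) ε * r^2| = (1/2) * (A2 * r^2) := by
      rw [abs_mul, abs_mul, abs_of_nonneg (sq_nonneg r), abs_of_pos (one_half_pos : (0:ℝ) < 1/2), mul_assoc]
    have e2 := mul_le_mul_of_nonneg_left hr2 hA2
    have e3 : 0 ≤ A2 * r^2 := mul_nonneg hA2 (sq_nonneg r)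
    rw [e1]; linarith
  have hηη : (A + A2 + η1) * η2 ≤ η := by
    have : η2 ≤ η / (A + A2 + η1) := min_le_right _ _
    rw [le_div_iff₀ (by positivity)] at this
    linarith
  have hημ : η1 * μ2Kt ≤ η := by
    rw [hη1, div_mul_eq_mul_div, div_le_iff₀ (by positivity)]; nlinarith
  have : I - (h₀ ε + (1/2) * μ2Kt * deriv (deriv h₀) ε * b^2) =
    (I - (h₀ ε + deriv h₀ ε * r + (1/2) * deriv (deriv h₀) ε * (r^2 + μ2Kt * b^2)))
      + deriv h₀ ε * r + (1/2) * deriv (deriv h₀) ε * r^2 := by ring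
  rw [this]
  calc _ ≤ η1 * (r^2 + μ2Kt * b^2) + A * |r| + A2 * |r| := by
        exact (abs_add_three _ _ _).trans (add_le_add (add_le_add h1 t1.le) t2)
    _ ≤ (A + A2 + η1) * |r| + η1 * μ2Kt * b^2 := by
        have := mul_le_mul_of_nonneg_left hr2 hη1p.le
        linarith
    _ ≤ (A + A2 + η1) * (η2 * w^2) + η1 * μ2Kt * b^2 := by gcongr
    _ = (A + A2 + η1) * η2 * w^2 + η1 * μ2Kt * b^2 := by ring
    _ ≤ η * w^2 + η * b^2 := by gcongr
    _ = _ := by ring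

lemma aux_kern {d : ℕ} (A : Matrix (Fin d) (Fin d) ℝ) (hA : A.det ≠ 0) (s₀ : Fin d → ℝ)
    (K : (Fin d → ℝ) → ℝ) (hK_int : (∫ u : Fin d → ℝ, K u) = 1)
    (F : (Fin d → ℝ) → ℝ) (c : ℝ) (hF : ∀ s, K (A⁻¹ *ᵥ (s - s₀)) ≠ 0 → |F s| ≤ c) :
    |∫ s, |A.det|⁻¹ * K (A⁻¹ *ᵥ (s - s₀)) * F s| ≤ c * ∫ u, |K u| := by
  have h1 : 1 ≤ ∫ u, |K u| := by
    have := norm_integral_le_integral_norm (μ := volume) K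
    rw [hK_int] at this; simpa using this
  have h2 := aux_cov A hA s₀ (fun u => |K u|)
  have h3 : Integrable (fun s => |A.det|⁻¹ * |K (A⁻¹ *ᵥ (s - s₀))|) := by
    by_contra h; rw [integral_undef h] at h2; linarith
  rw [← h2, ← integral_const_mul]
  rw [← Real.norm_eq_abs]
  refine norm_integral_le_of_norm_le (h3.const_mul c) (ae_of_all _ fun s => ?_)
  rw [Real.norm_eq_abs, abs_mul, abs_mul, abs_inv, abs_abs]
  by_cases h : K (A⁻¹ *ᵥ (s - s₀)) = 0
  · simp [h]
  rw [mul_comm c]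
  have := hF s h
  gcongr

lemma aux_supp {d : ℕ} (A : Matrix (Fin d) (Fin d) ℝ) (hA : A.det ≠ 0) (s₀ s : Fin d → ℝ)
    (K : (Fin d → ℝ) → ℝ) (R : ℝ) (hR : ∀ v, K v ≠ 0 → ‖v‖ ≤ R)
    (hs : K (A⁻¹ *ᵥ (s - s₀)) ≠ 0) : ‖s - s₀‖^2 ≤ (d * R^2) * (Aᵀ * A).trace := by
  have h1 := hR _ hs
  have h2 := aux_normB A (A⁻¹ *ᵥ (s - s₀))
  rw [mulVec_mulVec, mul_nonsing_inv _ hA.isUnit, one_mulVec] at h2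
  have ht : 0 ≤ (Aᵀ * A).trace := by
    simp only [trace, diag, mul_apply, transpose_apply]
    exact Finset.sum_nonneg fun i _ => Finset.sum_nonneg fun j _ => mul_self_nonneg _
  refine h2.trans ?_
  rw [mul_comm]
  gcongr

theorem quadratic_adjustment_bias_vanishes_homoscedastic
    (d : ℕ) (hd : 1 ≤ d)
    (f : ℝ → (Fin d → ℝ) → ℝ)
    (hf_meas : Measurable (Function.uncurry f))
    (hf_nonneg : ∀ t s, 0 ≤ f t s)
    (hf_bdd : ∃ M, ∀ t s, f t s ≤ M)
    (hf_int : ∫ x : ℝ × (Fin d → ℝ), f x.1 x.2 = 1)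
    (hf_smooth : ContDiff ℝ 2 (Function.uncurry f))
    (hf_d2bdd : ∃ M, ∀ x : ℝ × (Fin d → ℝ), ‖iteratedFDeriv ℝ 2 (Function.uncurry f) x‖ ≤ M)
    (p : (Fin d → ℝ) → ℝ) (hp_def : ∀ s, p s = ∫ t : ℝ, f t s)
    (g : ℝ → (Fin d → ℝ) → ℝ) (hg_def : ∀ t s, g t s = f t s / p s)
    (s₀ : Fin d → ℝ) (hps₀ : ∀ᶠ s in 𝓝 s₀, 0 < p s)
    (θ₀ : ℝ)
    (K : (Fin d → ℝ) → ℝ)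
    (hK_meas : Measurable K)
    (hK_bdd : ∃ M, ∀ u, |K u| ≤ M)
    (hK_supp : HasCompactSupport K)
    (hK_even : ∀ u, K (-u) = K u)
    (hK_int : (∫ u : Fin d → ℝ, K u) = 1)
    (μ2K : ℝ) (hμ2K_ne : μ2K ≠ 0)
    (hK_mom : ∀ i j, (∫ u : Fin d → ℝ, u i * u j * K u) = if i = j then μ2K else 0)
    (KB : Matrix (Fin d) (Fin d) ℝ → (Fin d → ℝ) → ℝ)
    (hKB : ∀ A u, KB A u = |A.det|⁻¹ * K (A⁻¹.mulVec u))
    (Kt : ℝ → ℝ)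
    (hKt_meas : Measurable Kt)
    (hKt_bdd : ∃ M, ∀ u, |Kt u| ≤ M)
    (hKt_supp : HasCompactSupport Kt)
    (hKt_nonneg : ∀ u, 0 ≤ Kt u)
    (hKt_int : (∫ u : ℝ, Kt u) = 1)
    (hKt_even : ∀ u, Kt (-u) = Kt u)
    (μ2Kt : ℝ) (hμ2Kt : μ2Kt = ∫ u : ℝ, u ^ 2 * Kt u)
    (Ktb : ℝ → ℝ → ℝ) (hKtb : ∀ c u, Ktb c u = Kt (u / c) / c)
    (m : (Fin d → ℝ) → ℝ) (hm_def : ∀ s, m s = ∫ t : ℝ, t * g t s)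
    (ε : ℝ) (hε : ε = θ₀ - m s₀)
    (gm : Fin d → ℝ) (hgm : ∀ i, gm i = fderiv ℝ m s₀ (Pi.single i 1))
    (h₀ : ℝ → ℝ) (hh₀_smooth : ContDiff ℝ 2 h₀)
    (hh₀_nonneg : ∀ t, 0 ≤ h₀ t) (hh₀_int : (∫ t : ℝ, h₀ t) = 1)
    (U : Set (Fin d → ℝ)) (hU : U ∈ 𝓝 s₀)
    (hhomo : ∀ s ∈ U, ∀ t, g t s = h₀ (t - m s))
    (hm_smooth : ContDiffAt ℝ 2 m s₀)
    (Hm : Matrix (Fin d) (Fin d) ℝ)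
    (hHm : ∀ i j, Hm i j = fderiv ℝ (fun s => fderiv ℝ m s (Pi.single j 1)) s₀ (Pi.single i 1))
    (B : ℕ → Matrix (Fin d) (Fin d) ℝ)
    (hBdet : ∀ n, (B n).det ≠ 0)
    (hB0 : Tendsto (fun n => ((B n)ᵀ * B n).trace) atTop (𝓝 0))
    (b' : ℕ → ℝ) (hb'pos : ∀ n, 0 < b' n) (hb'0 : Tendsto b' atTop (𝓝 0))
    (N₂ : ℕ → ℝ)
    (hN₂ : ∀ n, N₂ n =
      ∫ t : ℝ, ∫ s : Fin d → ℝ,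
        Ktb (b' n) (t - gm ⬝ᵥ (s - s₀) - (1 / 2) * ((s - s₀) ⬝ᵥ (Hm *ᵥ (s - s₀))) - θ₀)
          * KB (B n) (s - s₀) * f t s)
    (D : ℕ → ℝ)
    (hD : ∀ n, D n = ∫ s : Fin d → ℝ, KB (B n) (s - s₀) * p s) :
    (fun n =>
        N₂ n / D n - g θ₀ s₀ - (1 / 2) * μ2Kt * deriv (deriv h₀) ε * (b' n) ^ 2)
      =o[atTop] (fun n => (b' n) ^ 2 + ((B n)ᵀ * B n).trace) := by
  obtain ⟨MK, hMK⟩ := hK_bdd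
  obtain ⟨MKt, hMKt⟩ := id hKt_bdd
  obtain ⟨R, hR0, hR⟩ := aux_supp_bdd K hK_supp
  have hfI : Integrable (Function.uncurry f) (volume.prod volume) := by
    by_contra h
    have h0 : ∫ x : ℝ × (Fin d → ℝ), f x.1 x.2 = 0 := integral_undef h
    linarith
  have hpI : Integrable p := by
    have := hfI.integral_prod_right
    exact this.congr (ae_of_all _ fun s => (hp_def s).symm)
  have hp0 : 0 < p s₀ := hps₀.self_of_nhds
  have hs0U : s₀ ∈ U := mem_of_mem_nhds hU
  have hfp : ∀ s ∈ U, 0 < p s → ∀ t, f t s = p s * h₀ (t - m s) := fun s hs hps t => by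
    rw [← hhomo s hs t, hg_def]; field_simp
  have hmc : ContinuousAt m s₀ := hm_smooth.continuousAt
  -- continuity of p
  have hpc : ContinuousAt p s₀ := by
    obtain ⟨τ, hτ⟩ : ∃ τ, h₀ τ ≠ 0 := by
      by_contra! h
      simp [h] at hh₀_int
    have hne : h₀ (τ + m s₀ - m s₀) ≠ 0 := by simpa using hτ
    have hden : ContinuousAt (fun s => h₀ (τ + m s₀ - m s)) s₀ := by
      have : ContinuousAt h₀ (τ + m s₀ - m s₀) := hh₀_smooth.continuous.continuousAt
      exact ContinuousAt.comp (f := fun s => τ + m s₀ - m s) (g := h₀) this (continuousAt_const.sub hmc)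
    have hnum : ContinuousAt (fun s => f (τ + m s₀) s) s₀ := by
      have : Continuous (fun s => Function.uncurry f (τ + m s₀, s)) := hf_smooth.continuous.comp (by fun_prop)
      exact this.continuousAt
    refine (hnum.div hden hne).congr ?_
    filter_upwards [hps₀, hU, hden.eventually_ne hne] with s h1 h2 h3
    simp only [Pi.div_apply]
    rw [hfp s h2 h1]; field_simp
  set a : (Fin d → ℝ) → ℝ := fun s => gm ⬝ᵥ (s - s₀) + (1/2) * ((s - s₀) ⬝ᵥ (Hm *ᵥ (s - s₀))) with ha
  have hac : Continuous a := by
    simp only [ha, dotProduct, mulVec]; fun_prop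
  set k : ℕ → (Fin d → ℝ) → ℝ := fun n s => |(B n).det|⁻¹ * K ((B n)⁻¹ *ᵥ (s - s₀)) with hk
  have hkmeas : ∀ n, Measurable (k n) := fun n => by
    have : Continuous (fun s : Fin d → ℝ => (B n)⁻¹ *ᵥ (s - s₀)) := by
      fun_prop
    exact (hK_meas.comp this.measurable).const_mul _
  have hkbdd : ∀ n s, ‖k n s‖ ≤ |(B n).det|⁻¹ * MK := fun n s => by
    simp only [hk, Real.norm_eq_abs, abs_mul, abs_inv, abs_abs]
    gcongr; exact hMK _
  have hkI : ∀ n, Integrable (k n) := fun n => by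
    by_contra h
    have h1 := aux_cov (B n) (hBdet n) s₀ K
    rw [integral_undef h, hK_int] at h1
    norm_num at h1
  have hk1 : ∀ n, ∫ s, k n s = 1 := fun n => (aux_cov (B n) (hBdet n) s₀ K).trans hK_int
  have hkpI : ∀ n, Integrable (fun s => k n s * p s) := fun n =>
    hpI.bdd_mul (hkmeas n).aestronglyMeasurable (ae_of_all _ (hkbdd n))
  set G : ℕ → (Fin d → ℝ) → ℝ := fun n s => ∫ t, Kt ((t - (a s + θ₀)) / b' n) / b' n * f t s with hG
  have hprodI : ∀ n, Integrable (fun x : ℝ × (Fin d → ℝ) =>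
      (Kt ((x.1 - (a x.2 + θ₀)) / b' n) / b' n * k n x.2) * Function.uncurry f x) (volume.prod volume) := fun n => by
    refine hfI.bdd_mul (c := (MKt / b' n) * (|(B n).det|⁻¹ * MK)) ?_ (ae_of_all _ fun x => ?_)
    · have h1 : Measurable (fun x : ℝ × (Fin d → ℝ) => (x.1 - (a x.2 + θ₀)) / b' n) := by
        have : Continuous (fun x : ℝ × (Fin d → ℝ) => (x.1 - (a x.2 + θ₀)) / b' n) := by fun_prop
        exact this.measurable
      exact (((hKt_meas.comp h1).div_const _).mul ((hkmeas n).comp measurable_snd)).aestronglyMeasurable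
    · rw [norm_mul]
      have h1 := hkbdd n x.2
      have h2 : ‖Kt ((x.1 - (a x.2 + θ₀)) / b' n) / b' n‖ ≤ MKt / b' n := by
        rw [norm_div, Real.norm_eq_abs, Real.norm_eq_abs, abs_of_pos (hb'pos n)]
        have := hb'pos n
        gcongr; exact hMKt _
      exact mul_le_mul h2 h1 (norm_nonneg _) ((norm_nonneg _).trans h2)
  have hinner : ∀ n s, ∫ t, (Kt ((t - (a s + θ₀)) / b' n) / b' n * k n s) * f t s = k n s * G n s := fun n s => by
    simp only [hG]
    rw [← integral_const_mul]
    congr 1; ext t; ring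
  have hN : ∀ n, N₂ n = ∫ s, k n s * G n s := fun n => by
    rw [hN₂]
    have h1 := integral_integral_swap (f := fun t s => (Kt ((t - (a s + θ₀)) / b' n) / b' n * k n s) * f t s) (hprodI n)
    simp only [hinner] at h1
    rw [← h1]
    congr 1; ext t; congr 1; ext s
    rw [hKtb, hKB]
    simp only [hk, ha]
    congr 4
    ring
  have hkGI : ∀ n, Integrable (fun s => k n s * G n s) := fun n => by
    have := (hprodI n).integral_prod_right
    simpa only [Function.uncurry, hinner] using this
  have hDk : ∀ n, D n = ∫ s, k n s * p s := fun n => by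
    rw [hD]; congr 1; ext s; rw [hKB]
  have hg0 : g θ₀ s₀ = h₀ ε := by rw [hhomo s₀ hs0U, hε]
  set KA := ∫ u, |K u| with hKA
  have hKA0 : 0 ≤ KA := integral_nonneg fun u => abs_nonneg _
  set C := (d : ℝ) * R^2 with hC
  have hC0 : 0 ≤ C := by positivity
  set T : ℕ → ℝ := fun n => ((B n)ᵀ * B n).trace with hT
  have hT0 : ∀ n, 0 ≤ T n := fun n => by
    simp only [hT, trace, diag, mul_apply, transpose_apply]
    exact Finset.sum_nonneg fun i _ => Finset.sum_nonneg fun j _ => mul_self_nonneg _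
  have hsupp : ∀ n s, K ((B n)⁻¹ *ᵥ (s - s₀)) ≠ 0 → ‖s - s₀‖^2 ≤ C * T n := fun n s hs =>
    aux_supp (B n) (hBdet n) s₀ s K R hR hs
  have hsmall : ∀ δ > 0, ∀ᶠ n in atTop, ∀ s, K ((B n)⁻¹ *ᵥ (s - s₀)) ≠ 0 → ‖s - s₀‖ < δ := by
    intro δ hδ
    have h1 : Tendsto (fun n => C * T n) atTop (𝓝 0) := by simpa using hB0.const_mul C
    filter_upwards [h1.eventually_lt_const (show 0 < δ^2 by positivity)] with n hn s hs
    exact lt_of_pow_lt_pow_left₀ 2 hδ.le ((hsupp n s hs).trans_lt hn)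
  -- D is bounded below
  have hDlow : ∀ᶠ n in atTop, p s₀ / 2 ≤ D n := by
    have hη : 0 < p s₀ / 2 / (KA + 1) := by positivity
    obtain ⟨δ, hδ, H⟩ := Metric.continuousAt_iff.1 hpc _ hη
    filter_upwards [hsmall δ hδ] with n hn
    have h1 : D n - p s₀ = ∫ s, k n s * (p s - p s₀) := by
      simp_rw [mul_sub]
      rw [integral_sub (hkpI n) ((hkI n).mul_const _), integral_mul_const, hk1, hDk, one_mul]
    have h2 := aux_kern (B n) (hBdet n) s₀ K hK_int (fun s => p s - p s₀) (p s₀ / 2 / (KA + 1))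
      (fun s hs => by
        have := H (x := s) (by rw [dist_eq_norm]; exact hn s hs)
        rw [Real.dist_eq] at this; exact this.le)
    have h3 : |D n - p s₀| ≤ p s₀ / 2 / (KA + 1) * KA := by rw [h1]; exact h2
    have h4 : p s₀ / 2 / (KA + 1) * KA ≤ p s₀ / 2 := by
      rw [div_mul_eq_mul_div, div_le_iff₀ (by positivity)]; nlinarith
    have := (abs_le.1 (h3.trans h4)).1
    linarith
  rw [isLittleO_iff]
  intro η hη
  set P := p s₀ + 1 with hP
  have hPpos : 0 < P := by positivity
  set η' := η * (p s₀ / 2) / ((1 + C) * (KA + 1)) with hη'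
  have hη'p : 0 < η' := by positivity
  obtain ⟨δ1, hδ1, H1⟩ := aux_local h₀ hh₀_smooth Kt hKt_meas hKt_bdd hKt_supp hKt_nonneg hKt_int hKt_even
    μ2Kt hμ2Kt m s₀ hm_smooth gm hgm Hm hHm θ₀ ε hε (η' / P) (by positivity)
  have hgood : ∀ᶠ s in 𝓝 s₀, s ∈ U ∧ 0 < p s ∧ p s < P := by
    filter_upwards [hU, hps₀, hpc.eventually_lt_const (show p s₀ < P by linarith)] with s h1 h2 h3
    exact ⟨h1, h2, h3⟩
  obtain ⟨δ2, hδ2, H2⟩ := Metric.eventually_nhds_iff_ball.1 hgood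
  filter_upwards [hDlow, hsmall δ1 hδ1, hsmall δ2 hδ2, hb'0.eventually_lt_const hδ1] with n hDn hn1 hn2 hbn
  set c := h₀ ε + (1/2) * μ2Kt * deriv (deriv h₀) ε * (b' n)^2 with hc
  have hDpos : 0 < D n := by linarith
  have hTn := hT0 n
  have hdiff : N₂ n - c * D n = ∫ s, k n s * (G n s - c * p s) := by
    have : (fun s => k n s * (G n s - c * p s)) = fun s => k n s * G n s - c * (k n s * p s) := by
      ext s; ring
    rw [this, integral_sub (hkGI n) ((hkpI n).const_mul c), integral_const_mul, hN, hDk]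
  have hmain : |N₂ n - c * D n| ≤ η' * ((b' n)^2 + C * T n) * KA := by
    rw [hdiff]
    refine aux_kern (B n) (hBdet n) s₀ K hK_int (fun s => G n s - c * p s) _ (fun s hs => ?_)
    obtain ⟨hsU, hps, hpP⟩ := H2 s (by rw [Metric.mem_ball, dist_eq_norm]; exact hn2 s hs)
    have h1 := H1 (b' n) (hb'pos n) hbn s (hn1 s hs)
    have h2 : G n s = p s * ∫ v, Kt v * h₀ (a s + θ₀ + b' n * v - m s) := by
      simp only [hG]
      rw [aux_cov1 Kt (fun t => f t s) _ _ (hb'pos n), ← integral_const_mul]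
      congr 1; ext v
      rw [hfp s hsU hps]; ring
    have h3 : G n s - c * p s = p s * ((∫ v, Kt v * h₀ (a s + θ₀ + b' n * v - m s)) - c) := by
      rw [h2]; ring
    have h4 := hsupp n s hs
    show |G n s - c * p s| ≤ _
    rw [h3, abs_mul, abs_of_pos hps]
    calc _ ≤ P * (η' / P * ((b' n)^2 + ‖s - s₀‖^2)) := by
          exact mul_le_mul hpP.le h1 (abs_nonneg _) hPpos.le
      _ = η' * ((b' n)^2 + ‖s - s₀‖^2) := by field_simp
      _ ≤ _ := by gcongr
  have heq : N₂ n / D n - g θ₀ s₀ - (1 / 2) * μ2Kt * deriv (deriv h₀) ε * (b' n) ^ 2 = (N₂ n - c * D n) / D n := by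
    rw [hg0, hc]; field_simp; ring
  have hb2 : 0 ≤ (b' n)^2 := sq_nonneg _
  rw [heq, Real.norm_eq_abs, Real.norm_eq_abs, abs_div, abs_of_pos hDpos, div_le_iff₀ hDpos,
    abs_of_nonneg (add_nonneg hb2 hTn)]
  calc |N₂ n - c * D n| ≤ η' * ((b' n)^2 + C * T n) * KA := hmain
    _ ≤ η' * ((1 + C) * ((b' n)^2 + T n)) * (KA + 1) := by
        gcongr
        · nlinarith [mul_nonneg hC0 hb2]
        · linarith
    _ = η * ((b' n)^2 + T n) * (p s₀ / 2) := by rw [hη']; field_simp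
    _ ≤ η * ((b' n)^2 + T n) * D n := by gcongr
end
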